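/- Fix reals ρ_e > 0, e ∈ [0,1), h ≥ 0, and define N(φ) = ρ_e/√(1 − e²·sin²φ) and Γ(φ) = −sin φ·[h·(1 − e²·sin²φ) + N(φ)·(1−e²)] / ((N(φ)+h)·(1 − e²·sin²φ)·cos φ). Let λ, φ : ℝ → ℝ be functions such that λ is twice differentiable, φ is differentiable, φ(s) ∈ (−π/2, π/2) for all s, and the geodesic equation λ''(s) + 2·Γ(φ(s))·λ'(s)·φ'(s) = 0 holds for all s. Then the function s ↦ (N(φ(s))+h)²·cos²(φ(s))·λ'(s) is constant on ℝ. -/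

import Mathlib

open Real

lemma one_sub_sq_mul_sin_sq_pos {e : ℝ} (he0 : 0 ≤ e) (he1 : e < 1) (x : ℝ) :
    0 < 1 - e ^ 2 * sin x ^ 2 := by
  nlinarith [sin_sq_le_one x, mul_le_mul_of_nonneg_left (sin_sq_le_one x) (sq_nonneg e)]

/-- Derivative of the prime vertical radius of curvature with respect to latitude. -/
lemma hasDerivAt_div_sqrt_one_sub_sq_mul_sin_sq (ρ : ℝ) {e x : ℝ}
    (hw : 0 < 1 - e ^ 2 * sin x ^ 2) :
    HasDerivAt (fun y => ρ / √(1 - e ^ 2 * sin y ^ 2))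
      (ρ / √(1 - e ^ 2 * sin x ^ 2) * (e ^ 2 * sin x * cos x) / (1 - e ^ 2 * sin x ^ 2)) x := by
  have hr : 0 < √(1 - e ^ 2 * sin x ^ 2) := sqrt_pos.2 hw
  have hd := (((((hasDerivAt_sin x).pow 2).const_mul (e ^ 2)).const_sub 1).sqrt hw.ne')
  refine ((hasDerivAt_const x ρ).div hd hr.ne').congr_deriv ?_
  simp only [Pi.pow_apply]
  rw [sq_sqrt hw.le]
  field_simp
  push_cast
  ring

/-- If `F' = (Γ ∘ φ) φ' F` and `v' + 2 (Γ ∘ φ) v φ' = 0`, then `F² v` has derivative zero. -/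
lemma hasDerivAt_sq_mul_eq_zero {F v : ℝ → ℝ} {g v' p s : ℝ}
    (hF : HasDerivAt F (g * F s * p) s) (hv : HasDerivAt v v' s)
    (h : v' + 2 * g * v s * p = 0) :
    HasDerivAt (fun t => F t ^ 2 * v t) 0 s := by
  refine ((hF.pow 2).mul hv).congr_deriv ?_
  simp only [Pi.pow_apply]
  push_cast
  linear_combination F s ^ 2 * h

/-- Clairaut-type first integral: along a solution of the longitude component of
the geodesic equations, `(N(φ(s))+h)²·cos²(φ(s))·λ'(s)` is constant. -/
theorem clairaut_first_integral
    (ρe e h : ℝ) (hρe : 0 < ρe) (he0 : 0 ≤ e) (he1 : e < 1) (hh : 0 ≤ h)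
    (N Γ : ℝ → ℝ)
    (hN : ∀ φ : ℝ, N φ = ρe / Real.sqrt (1 - e ^ 2 * Real.sin φ ^ 2))
    (hΓ : ∀ φ : ℝ, Γ φ =
      -Real.sin φ * (h * (1 - e ^ 2 * Real.sin φ ^ 2) + N φ * (1 - e ^ 2)) /
        ((N φ + h) * (1 - e ^ 2 * Real.sin φ ^ 2) * Real.cos φ))
    (lam φ : ℝ → ℝ)
    (hlam : Differentiable ℝ lam) (hlam' : Differentiable ℝ (deriv lam))
    (hφdiff : Differentiable ℝ φ)
    (hφrange : ∀ s : ℝ, φ s ∈ Set.Ioo (-(Real.pi / 2)) (Real.pi / 2))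
    (hgeo : ∀ s : ℝ,
      deriv (deriv lam) s + 2 * Γ (φ s) * deriv lam s * deriv φ s = 0) :
    ∀ s t : ℝ,
      (N (φ s) + h) ^ 2 * Real.cos (φ s) ^ 2 * deriv lam s =
        (N (φ t) + h) ^ 2 * Real.cos (φ t) ^ 2 * deriv lam t := by
  have hF : ∀ s, HasDerivAt (fun t => (N (φ t) + h) * cos (φ t))
      (Γ (φ s) * ((N (φ s) + h) * cos (φ s)) * deriv φ s) s := by
    intro s
    have hw := one_sub_sq_mul_sin_sq_pos he0 he1 (φ s)
    have hc : 0 < cos (φ s) := cos_pos_of_mem_Ioo (hφrange s)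
    have hNpos : 0 < N (φ s) := by
      rw [hN]
      exact div_pos hρe (sqrt_pos.2 hw)
    have hNh : N (φ s) + h ≠ 0 := by positivity
    have hN' := hasDerivAt_div_sqrt_one_sub_sq_mul_sin_sq ρe hw
    rw [← funext hN, ← hN] at hN'
    have hG := ((hN'.add_const h).mul (hasDerivAt_cos (φ s))).comp s (hφdiff s).hasDerivAt
    refine hG.congr_deriv ?_
    rw [hΓ]
    congr 1
    have hw' := hw.ne'
    field_simp
    linear_combination sin (φ s) * N (φ s) * e ^ 2 * sin_sq_add_cos_sq (φ s)
  have hd : ∀ s, HasDerivAt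
      (fun t => (N (φ t) + h) ^ 2 * cos (φ t) ^ 2 * deriv lam t) 0 s := by
    intro s
    simpa only [mul_pow] using
      hasDerivAt_sq_mul_eq_zero (hF s) (hlam' s).hasDerivAt (hgeo s)
  exact is_const_of_deriv_eq_zero (fun s => (hd s).differentiableAt) (fun s => (hd s).deriv)
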